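/- arXiv:1711.04265 — 2 statements merged into one kernel-verified Lean document; each statement's English description precedes it below -/
import Mathlib

section
/- Let x = (x_n) be a real sequence. Then the set {ω ∈ (0,1] : Γ_x = Γ_{x↾ω}} has Lebesgue measure 1, i.e., λ({ω ∈ (0,1] : Γ_x = Γ_{x↾ω}}) = 1, where λ is the Lebesgue measure on ℝ. -/
open Filter Set Topology
open scoped Classical

/-- Upper asymptotic density `d*(X) = limsup_{n→∞} |X ∩ [1,n]| / n`. -/
noncomputable def upperDensity (X : Set ℕ) : ℝ :=
  Filter.limsup
    (fun n : ℕ => (((Finset.Icc 1 n).filter (fun i => i ∈ X)).card : ℝ) / n)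
    Filter.atTop

/-- `ℓ` is an ordinary limit point of `x`: some subsequence converges to `ℓ`. -/
def IsLimitPt (x : ℕ → ℝ) (ℓ : ℝ) : Prop :=
  ∃ φ : ℕ → ℕ, StrictMono φ ∧
    Filter.Tendsto (fun k => x (φ k)) Filter.atTop (nhds ℓ)

/-- `L_x`, the set of ordinary limit points of `x`. -/
def limitPts (x : ℕ → ℝ) : Set ℝ := {ℓ | IsLimitPt x ℓ}

/-- `ℓ` is a statistical cluster point of `x`. -/
def IsStatClusterPt (x : ℕ → ℝ) (ℓ : ℝ) : Prop :=
  ∀ ε : ℝ, 0 < ε → 0 < upperDensity {n : ℕ | |x n - ℓ| ≤ ε}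

/-- `Γ_x`, the set of statistical cluster points of `x`. -/
def statClusterPts (x : ℕ → ℝ) : Set ℝ := {ℓ | IsStatClusterPt x ℓ}

/-- `ℓ` is a statistical limit point of `x`: some subsequence along an index set
of positive upper density converges to `ℓ`. -/
def IsStatLimitPt (x : ℕ → ℝ) (ℓ : ℝ) : Prop :=
  ∃ φ : ℕ → ℕ, StrictMono φ ∧
    Filter.Tendsto (fun k => x (φ k)) Filter.atTop (nhds ℓ) ∧
    0 < upperDensity (Set.range φ)

/-- `Λ_x`, the set of statistical limit points of `x`. -/
def statLimitPts (x : ℕ → ℝ) : Set ℝ := {ℓ | IsStatLimitPt x ℓ}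

/-- The `n`-th binary digit (`n ≥ 1`) of `ω ∈ (0,1]` in the unique binary
representation of `ω` having infinitely many digits equal to `1`:
the partial sums of that representation are `s_N = (⌈2^N ω⌉ - 1)/2^N`. -/
noncomputable def binDigit (ω : ℝ) (n : ℕ) : ℤ :=
  ⌈(2 : ℝ) ^ n * ω⌉ - 2 * ⌈(2 : ℝ) ^ (n - 1) * ω⌉ + 1

/-- The set of indices `n ≥ 1` with `d_n(ω) = 1`. -/
def digitOneSet (ω : ℝ) : Set ℕ := {n | 1 ≤ n ∧ binDigit ω n = 1}

/-- The subsequence `x↾ω` of `x` obtained by choosing, in increasing order,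
all indices `n` with `d_n(ω) = 1`. -/
noncomputable def subseq (x : ℕ → ℝ) (ω : ℝ) : ℕ → ℝ :=
  fun k => x (Nat.nth (fun n => n ∈ digitOneSet ω) k)

/-- `q_{ω,m}(N)`: the proportion, among the first `N` terms of `x↾ω`,
of those within `1/m` of `ℓ`. -/
noncomputable def qdens (x : ℕ → ℝ) (ℓ : ℝ) (ω : ℝ) (m N : ℕ) : ℝ :=
  (((Finset.range N).filter (fun i => |subseq x ω i - ℓ| ≤ 1 / m)).card : ℝ) / N

open MeasureTheory

/-! ### Sets of zero density -/

/-- The number of elements of `X` less than `n`. -/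
noncomputable def countBelow (X : Set ℕ) (n : ℕ) : ℕ :=
  Nat.count (· ∈ X) n

theorem countBelow_zero (X : Set ℕ) : countBelow X 0 = 0 :=
  Nat.count_zero _

theorem countBelow_succ (X : Set ℕ) (n : ℕ) :
    countBelow X (n + 1) = countBelow X n + if n ∈ X then 1 else 0 :=
  Nat.count_succ _ _

theorem countBelow_mono {X Y : Set ℕ} (hXY : X ⊆ Y) (n : ℕ) : countBelow X n ≤ countBelow Y n :=
  Nat.count_mono_left fun _ _ h => hXY h

theorem countBelow_univ (n : ℕ) : countBelow univ n = n := by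
  induction n with
  | zero => exact countBelow_zero _
  | succ n ih => simp [countBelow_succ, ih]

/-- The set `X` has asymptotic density zero. -/
def HasZeroDensity (X : Set ℕ) : Prop :=
  Tendsto (fun n : ℕ => (countBelow X n : ℝ) / n) atTop (𝓝 0)

theorem abs_card_Icc_filter_sub_count_le (X : Set ℕ) (n : ℕ) :
    |(((Finset.Icc 1 n).filter (fun i => i ∈ X)).card : ℝ) - countBelow X n| ≤ 1 := by
  have h1 : ((Finset.Icc 1 n).filter (fun i => i ∈ X)).card ≤ countBelow X n + 1 := by
    rw [countBelow, Nat.count_eq_card_filter_range]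
    refine le_trans (Finset.card_le_card (t := insert n ((Finset.range n).filter (· ∈ X))) ?_)
      (Finset.card_insert_le _ _)
    intro i hi
    simp only [Finset.mem_filter, Finset.mem_Icc, Finset.mem_insert, Finset.mem_range] at hi ⊢
    rcases hi.1.2.lt_or_eq with h | h
    · exact Or.inr ⟨h, hi.2⟩
    · exact Or.inl h
  have h2 : countBelow X n ≤ ((Finset.Icc 1 n).filter (fun i => i ∈ X)).card + 1 := by
    rw [countBelow, Nat.count_eq_card_filter_range]
    refine le_trans (Finset.card_le_card
      (t := insert 0 ((Finset.Icc 1 n).filter (fun i => i ∈ X))) ?_) (Finset.card_insert_le _ _)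
    intro i hi
    simp only [Finset.mem_filter, Finset.mem_Icc, Finset.mem_insert, Finset.mem_range] at hi ⊢
    rcases Nat.eq_zero_or_pos i with h | h
    · exact Or.inl h
    · exact Or.inr ⟨⟨h, hi.1.le⟩, hi.2⟩
  rw [abs_le]
  constructor
  · have : (countBelow X n : ℝ) ≤ ((Finset.Icc 1 n).filter (fun i => i ∈ X)).card + 1 := by
      exact_mod_cast h2
    linarith
  · have : (((Finset.Icc 1 n).filter (fun i => i ∈ X)).card : ℝ) ≤ countBelow X n + 1 := by
      exact_mod_cast h1
    linarith

theorem hasZeroDensity_iff_tendsto_card_Icc (X : Set ℕ) :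
    HasZeroDensity X ↔ Tendsto
      (fun n : ℕ => (((Finset.Icc 1 n).filter (fun i => i ∈ X)).card : ℝ) / n) atTop (𝓝 0) := by
  have h : Tendsto (fun n : ℕ => (((Finset.Icc 1 n).filter (fun i => i ∈ X)).card : ℝ) / n
      - (countBelow X n : ℝ) / n) atTop (𝓝 0) := by
    refine squeeze_zero_norm (fun n => ?_) (tendsto_const_div_atTop_nhds_zero_nat (1 : ℝ))
    rw [← sub_div, Real.norm_eq_abs, abs_div, Nat.abs_cast]
    exact div_le_div_of_nonneg_right (abs_card_Icc_filter_sub_count_le X n) n.cast_nonneg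
  constructor
  · intro h0
    simpa using h.add h0
  · intro h0
    simpa [HasZeroDensity] using h0.sub h

theorem upperDensity_pos_iff (X : Set ℕ) : 0 < upperDensity X ↔ ¬ HasZeroDensity X := by
  rw [hasZeroDensity_iff_tendsto_card_Icc]
  unfold upperDensity
  set f : ℕ → ℝ := fun n => (((Finset.Icc 1 n).filter (fun i => i ∈ X)).card : ℝ) / n
  have h0 : ∀ n, 0 ≤ f n := fun n => by positivity
  have h1 : ∀ n, f n ≤ 1 := fun n => by
    refine div_le_one_of_le₀ ?_ n.cast_nonneg
    have := Finset.card_filter_le (Finset.Icc 1 n) (fun i => i ∈ X)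
    rw [Nat.card_Icc, Nat.add_sub_cancel] at this
    exact_mod_cast this
  have hb : IsBoundedUnder (· ≤ ·) atTop f := isBoundedUnder_of ⟨1, h1⟩
  have hb' : IsBoundedUnder (· ≥ ·) atTop f := isBoundedUnder_of ⟨0, h0⟩
  constructor
  · intro hpos hlim
    exact hpos.ne' hlim.limsup_eq
  · intro hlim
    by_contra hpos
    exact hlim (tendsto_of_le_liminf_of_limsup_le
      (le_liminf_of_le hb.isCoboundedUnder_ge (Eventually.of_forall h0)) (not_lt.mp hpos) hb hb')

theorem HasZeroDensity.mono {X Y : Set ℕ} (h : HasZeroDensity Y) (hXY : X ⊆ Y) :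
    HasZeroDensity X := by
  refine squeeze_zero (fun n => by positivity) (fun n => ?_) h
  have : countBelow X n ≤ countBelow Y n := countBelow_mono hXY n
  gcongr

theorem mem_statClusterPts_iff (y : ℕ → ℝ) (ℓ : ℝ) :
    ℓ ∈ statClusterPts y ↔
      ∀ a b : ℚ, (a : ℝ) < ℓ → ℓ < b → ¬ HasZeroDensity {n | y n ∈ Icc (a : ℝ) b} := by
  simp only [statClusterPts, mem_ofPred_eq, IsStatClusterPt, upperDensity_pos_iff]
  constructor
  · intro h a b ha hb hz
    refine h (min (ℓ - a) (b - ℓ)) (lt_min (by linarith) (by linarith)) (hz.mono fun n hn => ?_)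
    have hn' : |y n - ℓ| ≤ min (ℓ - a) (b - ℓ) := hn
    rw [le_min_iff, abs_le, abs_le] at hn'
    exact ⟨by linarith [hn'.1.1], by linarith [hn'.2.2]⟩
  · intro h ε hε hz
    obtain ⟨a, ha, ha'⟩ := exists_rat_btwn (show ℓ - ε < ℓ by linarith)
    obtain ⟨b, hb, hb'⟩ := exists_rat_btwn (show ℓ < ℓ + ε by linarith)
    refine h a b ha' hb (hz.mono fun n hn => ?_)
    have hn' : (a : ℝ) ≤ y n ∧ y n ≤ b := hn
    rw [mem_ofPred_eq, abs_le]
    exact ⟨by linarith [hn'.1], by linarith [hn'.2]⟩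

/-! ### Subsequences along sets of positive density -/

theorem countBelow_nth_preimage (A D : Set ℕ) (n : ℕ) :
    countBelow {k | Nat.nth (· ∈ D) k ∈ A} (countBelow D n) =
      countBelow (A ∩ D) n := by
  induction n with
  | zero => simp only [countBelow_zero]
  | succ n ih =>
    rw [countBelow_succ D, countBelow_succ (A ∩ D), ← ih]
    by_cases hn : n ∈ D
    · have hnth : Nat.nth (· ∈ D) (countBelow D n) = n := Nat.nth_count (p := (· ∈ D)) hn
      simp [hn, countBelow_succ, hnth]
    · simp [hn]

theorem hasZeroDensity_nth_preimage_iff (A D : Set ℕ)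
    (hD : Tendsto (fun n : ℕ => (countBelow D n : ℝ) / n) atTop (𝓝 (1 / 2)))
    (hA : Tendsto (fun n : ℕ => (2 * countBelow (A ∩ D) n - countBelow A n : ℝ) / n)
      atTop (𝓝 0)) :
    HasZeroDensity A ↔ HasZeroDensity {k | Nat.nth (· ∈ D) k ∈ A} := by
  have hinf : D.Infinite := by
    intro hfin
    have hbd : ∀ n, countBelow D n ≤ hfin.toFinset.card := fun n => by
      rw [countBelow, Nat.count_eq_card_filter_range]
      exact Finset.card_le_card fun i hi => by simpa using (Finset.mem_filter.mp hi).2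
    have h0 : Tendsto (fun n : ℕ => (countBelow D n : ℝ) / n) atTop (𝓝 0) :=
      squeeze_zero (fun n => by positivity)
        (fun n => div_le_div_of_nonneg_right (Nat.cast_le.mpr (hbd n)) n.cast_nonneg)
        (tendsto_const_div_atTop_nhds_zero_nat _)
    have := tendsto_nhds_unique h0 hD
    norm_num at this
  have hAD : HasZeroDensity A ↔ HasZeroDensity (A ∩ D) := by
    refine ⟨fun h => h.mono inter_subset_left, fun h => ?_⟩
    have := (h.const_mul 2).sub hA
    simp only [mul_zero, sub_zero] at this
    refine this.congr fun n => ?_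
    ring
  rw [hAD]
  constructor
  · intro h
    have hv : Tendsto (fun n : ℕ => (countBelow (A ∩ D) n : ℝ) / countBelow D n)
        atTop (𝓝 0) := by
      have := Tendsto.div h hD (by norm_num)
      rw [zero_div] at this
      refine this.congr' ?_
      filter_upwards [eventually_ge_atTop 1] with n hn
      have : (n : ℝ) ≠ 0 := by positivity
      simpa using div_div_div_cancel_right₀ this _ _
    refine (hv.comp (Nat.nth_strictMono (p := (· ∈ D)) hinf).tendsto_atTop).congr fun k => ?_
    have hk : countBelow D (Nat.nth (· ∈ D) k) = k := Nat.count_nth_of_infinite (p := (· ∈ D)) hinf k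
    have := countBelow_nth_preimage A D (Nat.nth (· ∈ D) k)
    rw [hk] at this
    simp only [Function.comp_apply, hk, this]
  · intro h
    have hcount : Tendsto (countBelow D) atTop atTop := by
      refine tendsto_atTop_atTop_of_monotone (Nat.count_monotone (· ∈ D)) fun k =>
        ⟨Nat.nth (· ∈ D) k, (Nat.count_nth_of_infinite (p := (· ∈ D)) hinf k).ge⟩
    have := (h.comp hcount).mul hD
    simp only [Function.comp_apply, countBelow_nth_preimage A D, zero_mul] at this
    refine this.congr fun n => ?_
    rcases eq_or_ne (countBelow D n) 0 with h0 | h0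
    · have : countBelow (A ∩ D) n ≤ countBelow D n :=
        countBelow_mono inter_subset_right n
      have h1 : countBelow (A ∩ D) n = 0 := by omega
      simp only [h1, Nat.cast_zero, zero_div, zero_mul]
    · have : (countBelow D n : ℝ) ≠ 0 := Nat.cast_ne_zero.mpr h0
      exact div_mul_div_cancel₀ this

/-! ### Rademacher functions -/

theorem binDigit_eq_zero_or_one (ω : ℝ) {n : ℕ} (hn : 1 ≤ n) :
    binDigit ω n = 0 ∨ binDigit ω n = 1 := by
  obtain ⟨m, rfl⟩ := Nat.exists_eq_add_of_le' hn
  simp only [binDigit, Nat.add_sub_cancel]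
  have h1 := Int.le_ceil ((2 : ℝ) ^ m * ω)
  have h2 := Int.ceil_lt_add_one ((2 : ℝ) ^ m * ω)
  have h3 := Int.le_ceil ((2 : ℝ) ^ (m + 1) * ω)
  have h4 := Int.ceil_lt_add_one ((2 : ℝ) ^ (m + 1) * ω)
  rw [pow_succ, mul_right_comm] at h3 h4 ⊢
  set t := (2 : ℝ) ^ m * ω
  have h5 : ⌈t * 2⌉ < 2 * ⌈t⌉ + 1 := by
    have : (⌈t * 2⌉ : ℝ) < 2 * ⌈t⌉ + 1 := by linarith
    exact_mod_cast this
  have h6 : 2 * ⌈t⌉ < ⌈t * 2⌉ + 2 := by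
    have : (2 * ⌈t⌉ : ℝ) < ⌈t * 2⌉ + 2 := by linarith
    exact_mod_cast this
  omega

theorem binDigit_add_of_lt (ω : ℝ) {i n : ℕ} (hin : i < n) :
    binDigit (ω + (2 ^ i)⁻¹) n = binDigit ω n := by
  obtain ⟨k, rfl⟩ := Nat.exists_eq_add_of_lt hin
  have h1 : (2 : ℝ) ^ (i + k) * (ω + (2 ^ i)⁻¹) = 2 ^ (i + k) * ω + ((2 ^ k : ℤ) : ℝ) := by
    push_cast
    field_simp
    ring
  have h2 : (2 : ℝ) ^ (i + k + 1) * (ω + (2 ^ i)⁻¹) =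
      2 ^ (i + k + 1) * ω + ((2 ^ (k + 1) : ℤ) : ℝ) := by
    push_cast
    field_simp
    ring
  simp only [binDigit, Nat.add_sub_cancel, h1, h2, Int.ceil_add_intCast]
  ring

theorem binDigit_add_self (ω : ℝ) {n : ℕ} (hn : 1 ≤ n) :
    binDigit (ω + (2 ^ n)⁻¹) n = 1 - binDigit ω n := by
  obtain ⟨m, rfl⟩ := Nat.exists_eq_add_of_le' hn
  have h1 : (2 : ℝ) ^ (m + 1) * (ω + (2 ^ (m + 1))⁻¹) = 2 ^ m * ω * 2 + 1 := by
    field_simp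
    ring
  have h2 : (2 : ℝ) ^ m * (ω + (2 ^ (m + 1))⁻¹) = 2 ^ m * ω + 1 / 2 := by
    field_simp
    ring
  have h3 : (2 : ℝ) ^ (m + 1) * ω = 2 ^ m * ω * 2 := by ring
  have hd := binDigit_eq_zero_or_one ω hn
  have hd' := binDigit_eq_zero_or_one (ω + (2 ^ (m + 1))⁻¹) hn
  simp only [binDigit, Nat.add_sub_cancel, h1, h2, h3, Int.ceil_add_one] at hd hd' ⊢
  set t := (2 : ℝ) ^ m * ω
  have e1 := Int.le_ceil t
  have e2 := Int.ceil_lt_add_one t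
  have e3 := Int.le_ceil (t + 1 / 2)
  have e4 := Int.ceil_lt_add_one (t + 1 / 2)
  have e5 := Int.le_ceil (t * 2)
  have e6 := Int.ceil_lt_add_one (t * 2)
  have f1 : ⌈t⌉ + ⌈t + 1 / 2⌉ < ⌈t * 2⌉ + 3 := by
    have : (⌈t⌉ + ⌈t + 1 / 2⌉ : ℝ) < ⌈t * 2⌉ + 3 := by linarith
    exact_mod_cast this
  have f2 : ⌈t * 2⌉ < ⌈t⌉ + ⌈t + 1 / 2⌉ + 1 := by
    have : (⌈t * 2⌉ : ℝ) < ⌈t⌉ + ⌈t + 1 / 2⌉ + 1 := by linarith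
    exact_mod_cast this
  have g1 : ⌈t⌉ ≤ ⌈t + 1 / 2⌉ := Int.ceil_mono (by linarith)
  have g2 : ⌈t + 1 / 2⌉ ≤ ⌈t⌉ + 1 := by
    rw [← Int.ceil_add_one]
    exact Int.ceil_mono (by linarith)
  omega

/-- The function equal to `1` if `n` is selected by `ω` and to `-1` otherwise. -/
noncomputable def rademacher (n : ℕ) (ω : ℝ) : ℝ :=
  if n ∈ digitOneSet ω then 1 else -1

theorem abs_rademacher (n : ℕ) (ω : ℝ) : |rademacher n ω| = 1 := by
  unfold rademacher
  split_ifs <;> simp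

theorem rademacher_mul_self (n : ℕ) (ω : ℝ) : rademacher n ω * rademacher n ω = 1 := by
  unfold rademacher
  split_ifs <;> simp

theorem rademacher_zero (ω : ℝ) : rademacher 0 ω = -1 := by
  simp [rademacher, digitOneSet]

theorem rademacher_add_of_lt (ω : ℝ) {i n : ℕ} (hin : i < n) :
    rademacher n (ω + (2 ^ i)⁻¹) = rademacher n ω := by
  have h : n ∈ digitOneSet (ω + (2 ^ i)⁻¹) ↔ n ∈ digitOneSet ω := by
    simp only [digitOneSet, mem_ofPred_eq, binDigit_add_of_lt ω hin]
  simp only [rademacher, h]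

theorem rademacher_add_self (ω : ℝ) {n : ℕ} (hn : 1 ≤ n) :
    rademacher n (ω + (2 ^ n)⁻¹) = -rademacher n ω := by
  simp only [rademacher, digitOneSet, mem_ofPred_eq, binDigit_add_self ω hn]
  rcases binDigit_eq_zero_or_one ω hn with h | h <;> simp [h, hn]

theorem rademacher_periodic (n : ℕ) : Function.Periodic (rademacher n) 1 := by
  intro ω
  rcases Nat.eq_zero_or_pos n with rfl | hn
  · simp only [rademacher_zero]
  · simpa using rademacher_add_of_lt ω hn

theorem measurable_rademacher (n : ℕ) : Measurable (rademacher n) := by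
  refine Measurable.ite ?_ measurable_const measurable_const
  have hm : Measurable fun ω => binDigit ω n := by
    unfold binDigit
    fun_prop
  exact (MeasurableSet.const (1 ≤ n)).inter (hm (measurableSet_singleton 1))

theorem intervalIntegral_eq_zero_of_antiperiodic {g : ℝ → ℝ} {c : ℝ}
    (hper : Function.Periodic g 1) (hanti : Function.Antiperiodic g c) :
    ∫ ω in (0 : ℝ)..1, g ω = 0 := by
  have h1 : ∫ ω in (0 : ℝ)..1, g (ω + c) = ∫ ω in (0 : ℝ)..1, g ω := by
    rw [intervalIntegral.integral_comp_add_right]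
    simpa [add_comm] using hper.intervalIntegral_add_eq c 0
  simp only [hanti _, intervalIntegral.integral_neg] at h1
  linarith

theorem integral_rademacher_mul_of_lt {i j : ℕ} (hij : i < j) :
    ∫ ω in Ioc (0 : ℝ) 1, rademacher i ω * rademacher j ω = 0 := by
  rw [← intervalIntegral.integral_of_le zero_le_one]
  have hper : Function.Periodic (fun ω => rademacher i ω * rademacher j ω) 1 :=
    (rademacher_periodic i).mul (rademacher_periodic j)
  rcases Nat.eq_zero_or_pos i with rfl | hi
  · refine intervalIntegral_eq_zero_of_antiperiodic (c := (2 ^ j)⁻¹) hper fun ω => ?_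
    simp only [rademacher_zero, rademacher_add_self ω hij]
    ring
  · refine intervalIntegral_eq_zero_of_antiperiodic (c := (2 ^ i)⁻¹) hper fun ω => ?_
    simp only [rademacher_add_of_lt ω hij, rademacher_add_self ω hi]
    ring

theorem integral_rademacher_mul (i j : ℕ) :
    ∫ ω in Ioc (0 : ℝ) 1, rademacher i ω * rademacher j ω = if i = j then 1 else 0 := by
  rcases lt_trichotomy i j with h | rfl | h
  · rw [integral_rademacher_mul_of_lt h, if_neg h.ne]
  · simp [rademacher_mul_self]
  · simp_rw [mul_comm (rademacher i _)]
    rw [integral_rademacher_mul_of_lt h, if_neg h.ne']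

/-! ### A strong law of large numbers for weighted Rademacher sums -/

theorem integrable_rademacher_mul (i j : ℕ) :
    Integrable (fun ω => rademacher i ω * rademacher j ω) (volume.restrict (Ioc (0 : ℝ) 1)) := by
  refine Integrable.of_bound (C := 1)
    ((measurable_rademacher i).mul (measurable_rademacher j)).aestronglyMeasurable
    (Eventually.of_forall fun ω => ?_)
  rw [Real.norm_eq_abs, abs_mul, abs_rademacher, abs_rademacher, one_mul]

theorem sq_sum_rademacher (a : ℕ → ℝ) (n : ℕ) (ω : ℝ) :
    (∑ i ∈ Finset.range n, a i * rademacher i ω) ^ 2 =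
      ∑ i ∈ Finset.range n, ∑ j ∈ Finset.range n,
        a i * a j * (rademacher i ω * rademacher j ω) := by
  rw [sq, Finset.sum_mul_sum]
  refine Finset.sum_congr rfl fun i _ => Finset.sum_congr rfl fun j _ => ?_
  ring

theorem integrable_sq_sum_rademacher (a : ℕ → ℝ) (n : ℕ) :
    Integrable (fun ω => (∑ i ∈ Finset.range n, a i * rademacher i ω) ^ 2)
      (volume.restrict (Ioc (0 : ℝ) 1)) := by
  simp_rw [sq_sum_rademacher]
  exact integrable_finsetSum _ fun i _ => integrable_finsetSum _ fun j _ =>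
    (integrable_rademacher_mul i j).const_mul _

theorem integral_sq_sum_rademacher_le {a : ℕ → ℝ} (ha : ∀ i, |a i| ≤ 1) (n : ℕ) :
    ∫ ω in Ioc (0 : ℝ) 1, (∑ i ∈ Finset.range n, a i * rademacher i ω) ^ 2 ≤ n := by
  simp_rw [sq_sum_rademacher]
  rw [integral_finsetSum _ fun i _ => integrable_finsetSum _ fun j _ =>
    (integrable_rademacher_mul i j).const_mul _]
  calc ∑ i ∈ Finset.range n, ∫ ω in Ioc (0 : ℝ) 1, ∑ j ∈ Finset.range n,
        a i * a j * (rademacher i ω * rademacher j ω)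
      = ∑ i ∈ Finset.range n, a i * a i := by
        refine Finset.sum_congr rfl fun i hi => ?_
        rw [integral_finsetSum _ fun j _ => (integrable_rademacher_mul i j).const_mul _]
        simp_rw [integral_const_mul, integral_rademacher_mul]
        simp [Finset.mem_range.mp hi]
    _ ≤ ∑ _i ∈ Finset.range n, 1 := by
        refine Finset.sum_le_sum fun i _ => ?_
        rw [← abs_mul_abs_self]
        exact mul_le_one₀ (ha i) (abs_nonneg _) (ha i)
    _ = n := by simp

theorem tendsto_div_of_tendsto_sq {u : ℕ → ℝ} (hu : ∀ n, |u (n + 1) - u n| ≤ 1)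
    (h : Tendsto (fun m : ℕ => u (m ^ 2) / (m : ℝ) ^ 2) atTop (𝓝 0)) :
    Tendsto (fun n : ℕ => u n / n) atTop (𝓝 0) := by
  have hlip : ∀ n k, |u (n + k) - u n| ≤ k := by
    intro n k
    induction k with
    | zero => simp
    | succ k ih =>
      have := abs_sub_le (u (n + k + 1)) (u (n + k)) (u n)
      have := hu (n + k)
      rw [← add_assoc]
      push_cast
      linarith
  have hsqrt : Tendsto Nat.sqrt atTop atTop :=
    tendsto_atTop_atTop_of_monotone (fun _ _ h => Nat.sqrt_le_sqrt h) fun m =>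
      ⟨m * m, (Nat.sqrt_eq m).ge⟩
  have hlim : Tendsto (fun m : ℕ => |u (m ^ 2) / (m : ℝ) ^ 2| + 2 / m) atTop (𝓝 0) := by
    simpa using h.abs.add (tendsto_const_div_atTop_nhds_zero_nat (2 : ℝ))
  refine squeeze_zero_norm' ?_ (hlim.comp hsqrt)
  filter_upwards [eventually_ge_atTop 1] with n hn
  set m := Nat.sqrt n with hm
  have hm0 : 0 < m := Nat.sqrt_pos.mpr hn
  have h1 : m ^ 2 ≤ n := by rw [sq]; exact Nat.sqrt_le n
  have h2 : n ≤ m * m + m + m := Nat.sqrt_le_add n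
  obtain ⟨k, hk⟩ := Nat.exists_eq_add_of_le h1
  have hk2 : k ≤ 2 * m := by nlinarith
  have hk2' : (k : ℝ) ≤ 2 * m := by exact_mod_cast hk2
  have hmn : (m : ℝ) ^ 2 ≤ n := by exact_mod_cast h1
  have hm0' : (0 : ℝ) < m := by exact_mod_cast hm0
  have hun : |u n| ≤ |u (m ^ 2)| + 2 * m := by
    have e1 := hlip (m ^ 2) k
    rw [← hk] at e1
    have := abs_sub_abs_le_abs_sub (u n) (u (m ^ 2))
    linarith
  simp only [Function.comp_apply, ← hm]
  rw [Real.norm_eq_abs, abs_div, Nat.abs_cast, abs_div, abs_of_pos (pow_pos hm0' 2)]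
  calc |u n| / n ≤ (|u (m ^ 2)| + 2 * m) / (m : ℝ) ^ 2 := by gcongr
    _ = |u (m ^ 2)| / (m : ℝ) ^ 2 + 2 / m := by field_simp

theorem ae_tendsto_zero_of_summable_integral {α : Type*} [MeasurableSpace α] {μ : Measure α}
    {f : ℕ → α → ℝ} (hf : ∀ n, Integrable (f n) μ) (hf0 : ∀ n ω, 0 ≤ f n ω)
    (hsum : Summable fun n => ∫ ω, f n ω ∂μ) :
    ∀ᵐ ω ∂μ, Tendsto (fun n => f n ω) atTop (𝓝 0) := by
  have hint : ∀ n, 0 ≤ ∫ ω, f n ω ∂μ := fun n => integral_nonneg (hf0 n)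
  have htop : ∫⁻ ω, ∑' n, ENNReal.ofReal (f n ω) ∂μ ≠ ⊤ := by
    rw [lintegral_tsum fun n => (hf n).aestronglyMeasurable.aemeasurable.ennreal_ofReal]
    simp_rw [← ofReal_integral_eq_lintegral_ofReal (hf _) (Eventually.of_forall (hf0 _))]
    rw [← ENNReal.ofReal_tsum_of_nonneg hint hsum]
    exact ENNReal.ofReal_ne_top
  filter_upwards [ae_lt_top' (AEMeasurable.tsum
    fun n => (hf n).aestronglyMeasurable.aemeasurable.ennreal_ofReal) htop] with ω hω
  have := (ENNReal.tendsto_toReal ENNReal.zero_ne_top).comp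
    (ENNReal.tendsto_atTop_zero_of_tsum_ne_top hω.ne)
  simpa [Function.comp_def, ENNReal.toReal_ofReal (hf0 _ ω)] using this

theorem ae_tendsto_sum_rademacher_div {a : ℕ → ℝ} (ha : ∀ i, |a i| ≤ 1) :
    ∀ᵐ ω ∂(volume.restrict (Ioc (0 : ℝ) 1)),
      Tendsto (fun n : ℕ => (∑ i ∈ Finset.range n, a i * rademacher i ω) / n) atTop (𝓝 0) := by
  have key := ae_tendsto_zero_of_summable_integral (μ := volume.restrict (Ioc (0 : ℝ) 1))
    (f := fun m ω => (∑ i ∈ Finset.range (m ^ 2), a i * rademacher i ω) ^ 2 / ((m : ℝ) ^ 2) ^ 2)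
    (fun m => (integrable_sq_sum_rademacher a (m ^ 2)).div_const _)
    (fun m ω => by positivity)
    (by
      refine Summable.of_nonneg_of_le (fun m => integral_nonneg fun ω => by positivity)
        (fun m => ?_) (Real.summable_one_div_nat_pow.mpr one_lt_two)
      rw [integral_div]
      rcases Nat.eq_zero_or_pos m with rfl | hm
      · simp
      · have := integral_sq_sum_rademacher_le ha (m ^ 2)
        rw [div_le_div_iff₀ (by positivity) (by positivity)]
        push_cast at this
        nlinarith [pow_pos (Nat.cast_pos (α := ℝ).mpr hm) 2])
  filter_upwards [key] with ω hω
  refine tendsto_div_of_tendsto_sq (fun n => ?_) ?_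
  · rw [Finset.sum_range_succ, add_sub_cancel_left, abs_mul, abs_rademacher, mul_one]
    exact ha n
  · simp_rw [← div_pow] at hω
    have := hω.sqrt
    simp_rw [Real.sqrt_sq_eq_abs, Real.sqrt_zero] at this
    exact (tendsto_zero_iff_abs_tendsto_zero _).mpr this

theorem two_mul_count_inter_digitOneSet (A : Set ℕ) (ω : ℝ) (n : ℕ) :
    (2 * countBelow (A ∩ digitOneSet ω) n - countBelow A n : ℝ) =
      ∑ i ∈ Finset.range n, A.indicator 1 i * rademacher i ω := by
  induction n with
  | zero => simp [countBelow_zero]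
  | succ n ih =>
    rw [Finset.sum_range_succ, ← ih, countBelow_succ, countBelow_succ, rademacher]
    by_cases hA : n ∈ A <;> by_cases hD : n ∈ digitOneSet ω <;> simp [hA, hD] <;> ring

theorem ae_tendsto_count_inter_digitOneSet (A : Set ℕ) :
    ∀ᵐ ω ∂(volume.restrict (Ioc (0 : ℝ) 1)),
      Tendsto (fun n : ℕ =>
        (2 * countBelow (A ∩ digitOneSet ω) n - countBelow A n : ℝ) / n) atTop (𝓝 0) := by
  simp_rw [two_mul_count_inter_digitOneSet]
  refine ae_tendsto_sum_rademacher_div fun i => ?_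
  by_cases hi : i ∈ A <;> simp [hi]

theorem ae_tendsto_count_digitOneSet :
    ∀ᵐ ω ∂(volume.restrict (Ioc (0 : ℝ) 1)),
      Tendsto (fun n : ℕ => (countBelow (digitOneSet ω) n : ℝ) / n) atTop (𝓝 (1 / 2)) := by
  filter_upwards [ae_tendsto_count_inter_digitOneSet univ] with ω hω
  have := (hω.add_const 1).div_const 2
  rw [zero_add] at this
  refine this.congr' ?_
  filter_upwards [eventually_ge_atTop 1] with n hn
  have : (n : ℝ) ≠ 0 := by positivity
  simp only [univ_inter, countBelow_univ]
  field_simp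
  ring

theorem ae_statClusterPts_eq (x : ℕ → ℝ) :
    ∀ᵐ ω ∂(volume.restrict (Ioc (0 : ℝ) 1)),
      statClusterPts x = statClusterPts (subseq x ω) := by
  have hcount : ∀ᵐ ω ∂(volume.restrict (Ioc (0 : ℝ) 1)), ∀ a b : ℚ, Tendsto (fun n : ℕ =>
      (2 * countBelow ({n | x n ∈ Icc (a : ℝ) b} ∩ digitOneSet ω) n
        - countBelow {n | x n ∈ Icc (a : ℝ) b} n : ℝ) / n) atTop (𝓝 0) :=
    ae_all_iff.mpr fun a => ae_all_iff.mpr fun b => ae_tendsto_count_inter_digitOneSet _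
  filter_upwards [hcount, ae_tendsto_count_digitOneSet] with ω hω hD
  ext ℓ
  simp only [mem_statClusterPts_iff]
  exact forall₂_congr fun a b => imp_congr_right fun _ => imp_congr_right fun _ =>
    not_congr (hasZeroDensity_nth_preimage_iff _ _ hD (hω a b))

/-- Theorem 1: `λ({ω ∈ (0,1] : Γ_x = Γ_{x↾ω}}) = 1`. -/
theorem stmt11 (x : ℕ → ℝ) :
    MeasureTheory.volume
        {ω : ℝ | ω ∈ Set.Ioc (0 : ℝ) 1 ∧ statClusterPts x = statClusterPts (subseq x ω)} =
      1 := by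
  have h : {ω : ℝ | ω ∈ Ioc (0 : ℝ) 1 ∧ statClusterPts x = statClusterPts (subseq x ω)}
      =ᵐ[volume] Ioc (0 : ℝ) 1 := by
    filter_upwards [(ae_restrict_iff' measurableSet_Ioc).mp (ae_statClusterPts_eq x)] with ω hω
    exact propext ⟨fun h => h.1, fun h => ⟨h, hω h⟩⟩
  rw [measure_congr h, Real.volume_Ioc]
  norm_num
end

section
/- For every real sequence x = (x_n), the set Γ_x of statistical cluster points of x is a closed subset of ℝ. -/
open Filter Set Topology
open scoped Classical

lemma card_filter_div_le_one (X : Set ℕ) (n : ℕ) :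
    (((Finset.Icc 1 n).filter (fun i => i ∈ X)).card : ℝ) / n ≤ 1 := by
  refine div_le_one_of_le₀ ?_ (Nat.cast_nonneg n)
  have h := Finset.card_filter_le (Finset.Icc 1 n) (fun i => i ∈ X)
  rw [Nat.card_Icc, Nat.add_sub_cancel] at h
  exact_mod_cast h

lemma upperDensity_mono {X Y : Set ℕ} (h : X ⊆ Y) : upperDensity X ≤ upperDensity Y := by
  refine limsup_le_limsup (Eventually.of_forall fun n => ?_) ?_ ?_
  · dsimp only
    gcongr
  · exact IsBoundedUnder.isCoboundedUnder_le
      (isBoundedUnder_of ⟨0, fun n => by positivity⟩)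
  · exact isBoundedUnder_of ⟨1, card_filter_div_le_one Y⟩

/-- For every real sequence `x`, the set `Γ_x` of statistical cluster points is closed. -/
theorem stmt13 (x : ℕ → ℝ) :
    IsClosed (statClusterPts x) := by
  refine isClosed_of_closure_subset fun ℓ hℓ ε hε => ?_
  obtain ⟨ℓ', hℓ', hdist⟩ := Metric.mem_closure_iff.1 hℓ (ε / 2) (half_pos hε)
  refine (hℓ' (ε / 2) (half_pos hε)).trans_le (upperDensity_mono fun n hn => ?_)
  rw [dist_comm, Real.dist_eq] at hdist
  have hn' : |x n - ℓ'| ≤ ε / 2 := hn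
  change |x n - ℓ| ≤ ε
  linarith [abs_sub_le (x n) ℓ' ℓ]
end
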